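/- Let U be a Banach space, ρ > 0, T* > 0, and for ε > 0 let T_ε > 0 with T_ε → T* as ε → 0. Let u_ε, u ∈ L^∞(0,∞;U) with ‖u_ε(t)‖_U ≤ ρ and ‖u(t)‖_U ≤ ρ a.e. t > 0, and set h_ε(t) = ∫₀^t (u_ε(s) − u(s)) ds. If limsup_{ε→0} ∫₀^{T_ε} ‖h_ε(t)‖_U² dt = 0, then ‖h_ε(T_ε)‖_U → 0 as ε → 0. -/

import Mathlib

/- Statement 7 (auxiliary lemma (g34-0) in Theorem 4.2): if
`limsup_{ε→0} ∫₀^{T_ε} ‖h_ε(t)‖² dt = 0` for `h_ε(t) = ∫₀^t (u_ε − u)`, with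
`‖u_ε(t)‖, ‖u(t)‖ ≤ ρ` a.e. and `T_ε → T* > 0`, then `‖h_ε(T_ε)‖ → 0`. -/

open MeasureTheory Set Filter Topology

noncomputable section

/-- The primitive of a function bounded by `M` is `M`-Lipschitz. -/
theorem norm_setIntegral_Ioo_sub_le {U : Type*} [NormedAddCommGroup U] [NormedSpace ℝ U]
    {v : ℝ → U} {M : ℝ} (hv : AEStronglyMeasurable v (volume.restrict (Ioi 0)))
    (hM : ∀ᵐ t ∂(volume.restrict (Ioi 0)), ‖v t‖ ≤ M) {a b : ℝ} (ha : 0 ≤ a) (hab : a ≤ b) :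
    ‖(∫ s in Ioo 0 b, v s) - ∫ s in Ioo 0 a, v s‖ ≤ M * (b - a) := by
  have hint : ∀ t : ℝ, 0 ≤ t → IntervalIntegrable v volume 0 t := by
    intro t ht
    rw [intervalIntegrable_iff_integrableOn_Ioc_of_le ht]
    exact Integrable.of_bound
      (hv.mono_measure (Measure.restrict_mono Ioc_subset_Ioi_self le_rfl))
      M (ae_mono (Measure.restrict_mono Ioc_subset_Ioi_self le_rfl) hM)
  have heq : ∀ t : ℝ, 0 ≤ t → ∫ s in Ioo 0 t, v s = ∫ s in (0 : ℝ)..t, v s := by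
    intro t ht
    rw [intervalIntegral.integral_of_le ht, integral_Ioc_eq_integral_Ioo]
  rw [heq b (ha.trans hab), heq a ha,
    intervalIntegral.integral_interval_sub_left (hint b (ha.trans hab)) (hint a ha),
    ← abs_of_nonneg (sub_nonneg.2 hab)]
  refine intervalIntegral.norm_integral_le_of_norm_le_const_ae ?_
  filter_upwards [(ae_restrict_iff' measurableSet_Ioi).1 hM] with t ht hmem
  rw [uIoc_of_le hab] at hmem
  exact ht (ha.trans_lt hmem.1)

theorem norm_setIntegral_Ioo_le {U : Type*} [NormedAddCommGroup U] [NormedSpace ℝ U]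
    {v : ℝ → U} {M : ℝ} (hv : AEStronglyMeasurable v (volume.restrict (Ioi 0)))
    (hM : ∀ᵐ t ∂(volume.restrict (Ioi 0)), ‖v t‖ ≤ M) {t : ℝ} (ht : 0 ≤ t) :
    ‖∫ s in Ioo 0 t, v s‖ ≤ M * t := by
  simpa using norm_setIntegral_Ioo_sub_le hv hM le_rfl ht

/-- The final value of the primitive of a function bounded by `M` is controlled by the `L²` norm
of that primitive. -/
theorem norm_setIntegral_Ioo_pow_three_le {U : Type*} [NormedAddCommGroup U] [NormedSpace ℝ U]
    {v : ℝ → U} {M : ℝ} (hM0 : 0 < M) (hv : AEStronglyMeasurable v (volume.restrict (Ioi 0)))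
    (hM : ∀ᵐ t ∂(volume.restrict (Ioi 0)), ‖v t‖ ≤ M) {T : ℝ} (hT : 0 ≤ T) :
    ‖∫ s in Ioo 0 T, v s‖ ^ 3 ≤ 8 * M * ∫ t in Ioo 0 T, ‖∫ s in Ioo 0 t, v s‖ ^ 2 := by
  have hle := norm_setIntegral_Ioo_le hv hM hT
  have hlip : ∀ t ∈ Icc 0 T, ‖∫ s in Ioo 0 T, v s‖ - M * (T - t) ≤ ‖∫ s in Ioo 0 t, v s‖ := by
    intro t ht
    have h1 := norm_setIntegral_Ioo_sub_le hv hM ht.1 ht.2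
    have h2 := norm_sub_norm_le (∫ s in Ioo 0 T, v s) (∫ s in Ioo 0 t, v s)
    linarith
  have hcont : ContinuousOn (fun t => ∫ s in Ioo 0 t, v s) (Icc 0 T) := by
    refine (LipschitzOnWith.of_dist_le_mul (K := M.toNNReal) ?_).continuousOn
    intro x hx y hy
    rw [Real.coe_toNNReal _ hM0.le]
    rcases le_total x y with h | h
    · rw [dist_comm, dist_comm x, dist_eq_norm, Real.dist_eq, abs_of_nonneg (sub_nonneg.2 h)]
      exact norm_setIntegral_Ioo_sub_le hv hM hx.1 h
    · rw [dist_eq_norm, Real.dist_eq, abs_of_nonneg (sub_nonneg.2 h)]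
      exact norm_setIntegral_Ioo_sub_le hv hM hy.1 h
  have hint : IntegrableOn (fun t => ‖∫ s in Ioo 0 t, v s‖ ^ 2) (Ioo 0 T) :=
    ((hcont.norm.pow 2).integrableOn_Icc).mono_set Ioo_subset_Icc_self
  set a := ‖∫ s in Ioo 0 T, v s‖
  have ha : 0 ≤ a := norm_nonneg _
  have hd : 0 ≤ a / (2 * M) := by positivity
  have hMd : M * (a / (2 * M)) = a / 2 := by field_simp
  have hdT : 0 ≤ T - a / (2 * M) := by
    rw [sub_nonneg, div_le_iff₀ (by positivity)]
    nlinarith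
  have hsub : Ioo (T - a / (2 * M)) T ⊆ Ioo 0 T := Ioo_subset_Ioo_left hdT
  have hlow : (a / 2) ^ 2 * (a / (2 * M)) ≤ ∫ t in Ioo 0 T, ‖∫ s in Ioo 0 t, v s‖ ^ 2 := by
    calc (a / 2) ^ 2 * (a / (2 * M)) = ∫ _ in Ioo (T - a / (2 * M)) T, (a / 2) ^ 2 := by
          rw [setIntegral_const, smul_eq_mul, Real.volume_real_Ioo_of_le (by linarith)]
          ring
      _ ≤ ∫ t in Ioo (T - a / (2 * M)) T, ‖∫ s in Ioo 0 t, v s‖ ^ 2 := by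
          refine setIntegral_mono_on (by simp) (hint.mono_set hsub) measurableSet_Ioo ?_
          intro t ht
          have h1 := hlip t (Ioo_subset_Icc_self (hsub ht))
          have h2 : M * (T - t) ≤ M * (a / (2 * M)) :=
            mul_le_mul_of_nonneg_left (by linarith [ht.1]) hM0.le
          exact pow_le_pow_left₀ (by positivity) (by linarith) 2
      _ ≤ ∫ t in Ioo 0 T, ‖∫ s in Ioo 0 t, v s‖ ^ 2 :=
          setIntegral_mono_set hint (ae_of_all _ fun t => by positivity) hsub.eventuallyLE
  calc a ^ 3 = 8 * M * ((a / 2) ^ 2 * (a / (2 * M))) := by field_simp; norm_num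
    _ ≤ _ := mul_le_mul_of_nonneg_left hlow (by positivity)

theorem statement7
    {U : Type*} [NormedAddCommGroup U] [NormedSpace ℝ U] [CompleteSpace U]
    (ρ Tstar : ℝ) (hρ : 0 < ρ) (hTstar : 0 < Tstar)
    (Teps : ℝ → ℝ) (hTeps : ∀ ε : ℝ, 0 < ε → 0 < Teps ε)
    (hTconv : Tendsto Teps (𝓝[>] 0) (𝓝 Tstar))
    (ueps : ℝ → ℝ → U) (u : ℝ → U)
    (hmeas : ∀ ε : ℝ, 0 < ε → AEStronglyMeasurable (ueps ε) (volume.restrict (Ioi 0)))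
    (humeas : AEStronglyMeasurable u (volume.restrict (Ioi 0)))
    (hbound : ∀ ε : ℝ, 0 < ε → ∀ᵐ t ∂(volume.restrict (Ioi 0)), ‖ueps ε t‖ ≤ ρ)
    (hubound : ∀ᵐ t ∂(volume.restrict (Ioi 0)), ‖u t‖ ≤ ρ)
    (hlimsup : Filter.limsup
      (fun ε => ∫ t in Ioo 0 (Teps ε), ‖∫ s in Ioo 0 t, (ueps ε s - u s)‖ ^ 2)
      (𝓝[>] (0:ℝ)) = 0) :
    Tendsto (fun ε => ‖∫ s in Ioo 0 (Teps ε), (ueps ε s - u s)‖) (𝓝[>] (0:ℝ)) (𝓝 0) := by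
  have hv : ∀ ε : ℝ, 0 < ε →
      AEStronglyMeasurable (fun s => ueps ε s - u s) (volume.restrict (Ioi 0)) :=
    fun ε hε => (hmeas ε hε).sub humeas
  have hM : ∀ ε : ℝ, 0 < ε → ∀ᵐ t ∂(volume.restrict (Ioi 0)), ‖ueps ε t - u t‖ ≤ 2 * ρ := by
    intro ε hε
    filter_upwards [hbound ε hε, hubound] with t h1 h2
    linarith [norm_sub_le (ueps ε t) (u t)]
  have hpos : ∀ᶠ ε in 𝓝[>] (0 : ℝ), 0 < ε := eventually_mem_nhdsWithin
  have hbdd : IsBoundedUnder (· ≤ ·) (𝓝[>] (0 : ℝ))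
      (fun ε => ∫ t in Ioo 0 (Teps ε), ‖∫ s in Ioo 0 t, (ueps ε s - u s)‖ ^ 2) := by
    refine isBoundedUnder_of_eventually_le (a := (2 * ρ * (Tstar + 1)) ^ 2 * (Tstar + 1)) ?_
    filter_upwards [hpos, hTconv.eventually_lt_const (lt_add_one Tstar)] with ε hε hT
    have hT0 := hTeps ε hε
    refine (Real.le_norm_self _).trans ((norm_setIntegral_le_of_norm_le_const
      (C := (2 * ρ * (Tstar + 1)) ^ 2) (by simp) ?_).trans ?_)
    · intro t ht
      rw [norm_pow, norm_norm]
      refine pow_le_pow_left₀ (norm_nonneg _)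
        ((norm_setIntegral_Ioo_le (hv ε hε) (hM ε hε) ht.1.le).trans ?_) 2
      exact mul_le_mul_of_nonneg_left (ht.2.trans hT).le (by positivity)
    · refine mul_le_mul_of_nonneg_left ?_ (by positivity)
      simpa [hT0.le] using hT.le
  rw [Metric.tendsto_nhds]
  intro δ hδ
  have hlt := eventually_lt_of_limsup_lt
    (hlimsup.trans_lt (show 0 < δ ^ 3 / (8 * (2 * ρ)) by positivity)) hbdd
  filter_upwards [hpos, hlt] with ε hε h
  rw [dist_zero_right, norm_norm]
  have hcube := norm_setIntegral_Ioo_pow_three_le (by positivity) (hv ε hε) (hM ε hε)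
    (hTeps ε hε).le
  rw [lt_div_iff₀ (by positivity)] at h
  exact lt_of_pow_lt_pow_left₀ 3 hδ.le (by linarith)
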